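/- Discrete gradient stability: there exists a constant C > 0, independent of N, such that for every integer N ≥ 2, if (e¹, e², e_p) ∈ V_h^(1) × V_h^(2) × M_h satisfies the discrete Stokes system with residuals (R¹, R², R), then |e|₁ ≤ C ( ‖R¹‖_{V¹} + ‖R²‖_{V²} + ‖R‖_{M} ), where e = (e¹, e²). -/

import Mathlib

open Finset

noncomputable section

/-- mesh size `h = 1/N` -/
def gh (N : ℕ) : ℝ := 1 / (N : ℝ)

/-- weights `ρ_0 = ρ_N = 1/2`, `ρ_k = 1` otherwise -/
def rho (N k : ℕ) : ℝ := if k = 0 ∨ k = N then 1/2 else 1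

/-- membership in `V_h^(1)`: `v i j` denotes `v_{i, j-1/2}` for `0 ≤ i ≤ N`, `0 ≤ j ≤ N+1`
(index `j` corresponds to the half-integer ordinate `j - 1/2`). -/
def inV1 (N : ℕ) (v : ℕ → ℕ → ℝ) : Prop :=
  (∀ j, v 0 j = 0) ∧ (∀ j, v N j = 0) ∧
  (∀ i, v i 0 = - v i 1) ∧ (∀ i, v i (N+1) = - v i N)

/-- membership in `V_h^(2)`: `v i j` denotes `v_{i-1/2, j}` for `0 ≤ i ≤ N+1`, `0 ≤ j ≤ N`. -/
def inV2 (N : ℕ) (v : ℕ → ℕ → ℝ) : Prop :=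
  (∀ i, v i 0 = 0) ∧ (∀ i, v i N = 0) ∧
  (∀ j, v 0 j = - v 1 j) ∧ (∀ j, v (N+1) j = - v N j)

/-- membership in `M_h`: `q i j` denotes `q_{i-1/2, j-1/2}` for `1 ≤ i, j ≤ N`, discrete mean zero. -/
def inM (N : ℕ) (q : ℕ → ℕ → ℝ) : Prop :=
  ∑ i ∈ Icc 1 N, ∑ j ∈ Icc 1 N, q i j = 0

/-- `(·,·)_{M_h}` inner product (cell centers `1 ≤ i, j ≤ N`). -/
def innerM (N : ℕ) (q r : ℕ → ℕ → ℝ) : ℝ :=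
  gh N ^ 2 * ∑ i ∈ Icc 1 N, ∑ j ∈ Icc 1 N, q i j * r i j

/-- `(·,·)_{V_h^(1)}` inner product (nodes `(i, j-1/2)`, `1 ≤ i ≤ N-1`, `1 ≤ j ≤ N`). -/
def innerV1 (N : ℕ) (v w : ℕ → ℕ → ℝ) : ℝ :=
  gh N ^ 2 * ∑ i ∈ Icc 1 (N-1), ∑ j ∈ Icc 1 N, v i j * w i j

/-- `(·,·)_{V_h^(2)}` inner product (nodes `(i-1/2, j)`, `1 ≤ i ≤ N`, `1 ≤ j ≤ N-1`). -/
def innerV2 (N : ℕ) (v w : ℕ → ℕ → ℝ) : ℝ :=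
  gh N ^ 2 * ∑ i ∈ Icc 1 N, ∑ j ∈ Icc 1 (N-1), v i j * w i j

/-- `(·,·)_{W_h^(1)}` inner product (vertices `1 ≤ i ≤ N-1`, `0 ≤ j ≤ N`, weights `ρ_j`). -/
def innerW1 (N : ℕ) (v w : ℕ → ℕ → ℝ) : ℝ :=
  gh N ^ 2 * ∑ i ∈ Icc 1 (N-1), ∑ j ∈ Icc 0 N, rho N j * (v i j * w i j)

/-- `(·,·)_{W_h^(2)}` inner product (vertices `0 ≤ i ≤ N`, `1 ≤ j ≤ N-1`, weights `ρ_i`). -/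
def innerW2 (N : ℕ) (v w : ℕ → ℕ → ℝ) : ℝ :=
  gh N ^ 2 * ∑ i ∈ Icc 0 N, ∑ j ∈ Icc 1 (N-1), rho N i * (v i j * w i j)

/-- `δ⁻₁` of a `V_h^(1)` function, evaluated at the cell center `(i-1/2, j-1/2)`. -/
def d1V1 (N : ℕ) (v : ℕ → ℕ → ℝ) : ℕ → ℕ → ℝ := fun i j => (v i j - v (i-1) j) / gh N

/-- `δ⁻₂` of a `V_h^(1)` function, evaluated at the vertex `(i, j)`. -/
def d2V1 (N : ℕ) (v : ℕ → ℕ → ℝ) : ℕ → ℕ → ℝ := fun i j => (v i (j+1) - v i j) / gh N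

/-- `δ⁻₁` of a `V_h^(2)` function, evaluated at the vertex `(i, j)`. -/
def d1V2 (N : ℕ) (v : ℕ → ℕ → ℝ) : ℕ → ℕ → ℝ := fun i j => (v (i+1) j - v i j) / gh N

/-- `δ⁻₂` of a `V_h^(2)` function, evaluated at the cell center `(i-1/2, j-1/2)`. -/
def d2V2 (N : ℕ) (v : ℕ → ℕ → ℝ) : ℕ → ℕ → ℝ := fun i j => (v i j - v i (j-1)) / gh N

/-- `δ⁺₁` of a cell-centered function, evaluated at the node `(i, j-1/2)`. -/
def d1pM (N : ℕ) (q : ℕ → ℕ → ℝ) : ℕ → ℕ → ℝ := fun i j => (q (i+1) j - q i j) / gh N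

/-- `δ⁺₂` of a cell-centered function, evaluated at the node `(i-1/2, j)`. -/
def d2pM (N : ℕ) (q : ℕ → ℕ → ℝ) : ℕ → ℕ → ℝ := fun i j => (q i (j+1) - q i j) / gh N

/-- the five-point discrete Laplacian `Δ_h = δ⁺₁δ⁻₁ + δ⁺₂δ⁻₂`. -/
def lap (N : ℕ) (v : ℕ → ℕ → ℝ) : ℕ → ℕ → ℝ := fun i j =>
  (v (i+1) j - 2 * v i j + v (i-1) j) / gh N ^ 2
    + (v i (j+1) - 2 * v i j + v i (j-1)) / gh N ^ 2

/-- squared discrete `H¹` seminorm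
`|v|₁² = ‖δ⁻₁v¹‖²_M + ‖δ⁻₂v¹‖²_{W¹} + ‖δ⁻₁v²‖²_{W²} + ‖δ⁻₂v²‖²_M`. -/
def H1semisq (N : ℕ) (v1 v2 : ℕ → ℕ → ℝ) : ℝ :=
  innerM N (d1V1 N v1) (d1V1 N v1) + innerW1 N (d2V1 N v1) (d2V1 N v1)
    + innerW2 N (d1V2 N v2) (d1V2 N v2) + innerM N (d2V2 N v2) (d2V2 N v2)

/-- discrete `H¹` seminorm `|v|₁`. -/
def H1semi (N : ℕ) (v1 v2 : ℕ → ℕ → ℝ) : ℝ := Real.sqrt (H1semisq N v1 v2)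

/-- `(e¹, e², e_p)` satisfies the discrete MAC Stokes system with residuals `(R¹, R², R)`. -/
def StokesSys (N : ℕ) (e1 e2 ep R1 R2 R : ℕ → ℕ → ℝ) : Prop :=
  (∀ i ∈ Icc 1 (N-1), ∀ j ∈ Icc 1 N, -lap N e1 i j + d1pM N ep i j = R1 i j) ∧
  (∀ i ∈ Icc 1 N, ∀ j ∈ Icc 1 (N-1), -lap N e2 i j + d2pM N ep i j = R2 i j) ∧
  (∀ i ∈ Icc 1 N, ∀ j ∈ Icc 1 N, d1V1 N e1 i j + d2V2 N e2 i j = R i j)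


/-! ### One-dimensional tools -/

/-- summation by parts -/
lemma sbp_aux (f g : ℕ → ℝ) (n : ℕ) :
    ∑ i ∈ Icc 1 (n+1), g i * (f i - f (i-1)) =
      g (n+1) * f (n+1) - g 1 * f 0 - ∑ i ∈ Icc 1 n, f i * (g (i+1) - g i) := by
  induction n with
  | zero => simp; ring
  | succ n ih =>
    rw [Finset.sum_Icc_succ_top (by omega), ih, Finset.sum_Icc_succ_top (by omega)]
    simp only [Nat.add_sub_cancel]
    ring

lemma sbp (f g : ℕ → ℝ) (N : ℕ) (hN : 1 ≤ N) (h0 : f 0 = 0) (h1 : f N = 0) :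
    ∑ i ∈ Icc 1 N, g i * (f i - f (i-1)) = - ∑ i ∈ Icc 1 (N-1), f i * (g (i+1) - g i) := by
  obtain ⟨n, rfl⟩ : ∃ n, N = n + 1 := ⟨N-1, by omega⟩
  rw [sbp_aux, h0, h1]; simp

/-- discrete Cauchy-Schwarz bound for increments -/
lemma incr_aux (f : ℕ → ℝ) (a n : ℕ) :
    (f (a+n) - f a)^2 ≤ n * ∑ k ∈ Ico a (a+n), (f (k+1) - f k)^2 := by
  have h1 : f (a+n) - f a = ∑ k ∈ Ico a (a+n), (f (k+1) - f k) := by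
    rw [Finset.sum_Ico_sub f (by omega)]
  rw [h1]
  have := sq_sum_le_card_mul_sum_sq (s := Ico a (a+n)) (f := fun k => f (k+1) - f k)
  simpa using this

lemma incr (f : ℕ → ℝ) (L U N a b : ℕ) (hL : L ≤ a) (hab : a ≤ b) (hU : b ≤ U) (hN : U ≤ L + N) :
    (f b - f a)^2 ≤ N * ∑ k ∈ Ico L U, (f (k+1) - f k)^2 := by
  obtain ⟨n, rfl⟩ : ∃ n, b = a + n := ⟨b - a, by omega⟩
  refine (incr_aux f a n).trans ?_
  have h2 : ∑ k ∈ Ico a (a+n), (f (k+1) - f k)^2 ≤ ∑ k ∈ Ico L U, (f (k+1) - f k)^2 :=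
    Finset.sum_le_sum_of_subset_of_nonneg (Finset.Ico_subset_Ico hL hU) (fun _ _ _ => sq_nonneg _)
  have h3 : (n : ℝ) ≤ N := by exact_mod_cast (by omega : n ≤ N)
  have h4 : (0:ℝ) ≤ ∑ k ∈ Ico a (a+n), (f (k+1) - f k)^2 := Finset.sum_nonneg (fun _ _ => sq_nonneg _)
  exact mul_le_mul h3 h2 h4 (Nat.cast_nonneg _)

lemma incr' (f : ℕ → ℝ) (L U N a b : ℕ) (hL : L ≤ a) (hL' : L ≤ b) (ha : a ≤ U) (hU : b ≤ U)
    (hN : U ≤ L + N) :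
    (f b - f a)^2 ≤ N * ∑ k ∈ Ico L U, (f (k+1) - f k)^2 := by
  rcases le_total a b with h | h
  · exact incr f L U N a b hL h hU hN
  · have := incr f L U N b a hL' h ha hN
    nlinarith

/-- energy identity in the normal direction -/
lemma energy_x (v : ℕ → ℝ) (N : ℕ) (hN : 1 ≤ N) (h0 : v 0 = 0) (h1 : v N = 0) :
    ∑ i ∈ Icc 1 (N-1), (-(v (i+1) - 2 * v i + v (i-1))) * v i =
      ∑ i ∈ Icc 1 N, (v i - v (i-1))^2 := by
  have := sbp v (fun i => v i - v (i-1)) N hN h0 h1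
  simp only [Nat.add_sub_cancel] at this
  simp only [pow_two]
  rw [this, ← Finset.sum_neg_distrib]
  exact Finset.sum_congr rfl (fun i _ => by ring)

lemma energy_y_aux (v : ℕ → ℝ) (n : ℕ) :
    ∑ j ∈ Icc 1 (n+1), (-(v (j+1) - 2 * v j + v (j-1))) * v j =
      ∑ j ∈ Icc 1 n, (v (j+1) - v j)^2 + (v 1 - v 0) * v 1
        - (v (n+2) - v (n+1)) * v (n+1) := by
  induction n with
  | zero => simp; ring
  | succ n ih =>
    rw [Finset.sum_Icc_succ_top (by omega), ih, Finset.sum_Icc_succ_top (by omega)]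
    simp only [Nat.add_sub_cancel]
    ring_nf

lemma Icc_zero_split (f : ℕ → ℝ) (N : ℕ) (hN : 1 ≤ N) :
    ∑ j ∈ Icc 0 N, f j = f 0 + ∑ j ∈ Icc 1 (N-1), f j + f N := by
  obtain ⟨n, rfl⟩ : ∃ n, N = n + 1 := ⟨N-1, by omega⟩
  rw [Finset.sum_Icc_succ_top (by omega), ← Finset.add_sum_Ioc_eq_sum_Icc (by omega)]
  simp only [Nat.add_sub_cancel]
  rfl

/-- energy identity in the tangential direction -/
lemma energy_y (v : ℕ → ℝ) (N : ℕ) (hN : 1 ≤ N) (h0 : v 0 = - v 1) (h1 : v (N+1) = - v N) :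
    ∑ j ∈ Icc 1 N, (-(v (j+1) - 2 * v j + v (j-1))) * v j =
      ∑ j ∈ Icc 0 N, rho N j * (v (j+1) - v j)^2 := by
  rw [Icc_zero_split _ _ hN]
  have hr : ∑ j ∈ Icc 1 (N-1), rho N j * (v (j+1) - v j)^2
      = ∑ j ∈ Icc 1 (N-1), (v (j+1) - v j)^2 := by
    refine Finset.sum_congr rfl (fun j hj => ?_)
    rw [Finset.mem_Icc] at hj
    have : rho N j = 1 := by unfold rho; rw [if_neg (by omega)]
    rw [this, one_mul]
  rw [hr]
  have e0 : rho N 0 = 1/2 := by simp [rho]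
  have e1 : rho N N = 1/2 := by simp [rho]
  rw [e0, e1]
  obtain ⟨n, rfl⟩ : ∃ n, N = n + 1 := ⟨N-1, by omega⟩
  rw [energy_y_aux]
  simp only [Nat.add_sub_cancel]
  rw [show n + 1 + 1 = n + 2 from rfl] at *
  rw [h1]
  simp only [Nat.zero_add]
  rw [h0]
  ring

/-! ### Boundary distance -/

/-- integer distance of a vertex to the boundary -/
def eta (N i j : ℕ) : ℕ := min (min i (N-i)) (min j (N-j))

/-- twice the weight of a vertical edge -/
def wv (N i j : ℕ) : ℝ := (eta N i (j-1) : ℝ) + eta N i j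
/-- twice the weight of a horizontal edge -/
def wh (N i j : ℕ) : ℝ := (eta N (i-1) j : ℝ) + eta N i j

set_option maxHeartbeats 2000000 in
lemma div_key_int (N i j : ℕ) (hi : 1 ≤ i) (hi' : i ≤ N) (hj : 1 ≤ j) (hj' : j ≤ N) (p q s t : ℤ)
    (hp : p = (eta N (i-1) (j-1) : ℕ)) (hq : q = (eta N i (j-1) : ℕ))
    (hs : s = (eta N (i-1) j : ℕ)) (ht : t = (eta N i j : ℕ)) :
    6 * max |(N:ℤ)+1-2*i| |(N:ℤ)+1-2*j| - 4 * N ≤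
      ((N:ℤ)+1-2*i) * (q+t-p-s) + ((N:ℤ)+1-2*j) * (s+t-p-q) - 2*(p+q+s+t) := by
  unfold eta at *
  have key : ∀ p' q' s' t' M : ℤ, p = p' → q = q' → s = s' → t = t' →
      (|(N:ℤ)+1-2*i| ≤ M) → |(N:ℤ)+1-2*j| ≤ M →
    (6 * M - 4 * N ≤
      ((N:ℤ)+1-2*i) * (q'+t'-p'-s') + ((N:ℤ)+1-2*j) * (s'+t'-p'-q') - 2*(p'+q'+s'+t')) →
    6 * max |(N:ℤ)+1-2*i| |(N:ℤ)+1-2*j| - 4 * N ≤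
      ((N:ℤ)+1-2*i) * (q+t-p-s) + ((N:ℤ)+1-2*j) * (s+t-p-q) - 2*(p+q+s+t) := by
    intro p' q' s' t' M e1 e2 e3 e4 m1 m2 h
    subst e1 e2 e3 e4
    have := max_le m1 m2
    linarith
  have n1 : ((i-1:ℕ):ℤ) = i - 1 := by omega
  have n2 : ((j-1:ℕ):ℤ) = j - 1 := by omega
  rcases lt_trichotomy i j with h1 | h1 | h1 <;> rcases lt_trichotomy (i+j) (N+1) with h2 | h2 | h2
  · refine key (i-1) i (i-1) i (N+1-2*i) ?_ ?_ ?_ ?_ (abs_le.2 ⟨?_, ?_⟩) (abs_le.2 ⟨?_, ?_⟩) ?_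
    any_goals omega
  · refine key (i-1) i (i-1) (i-1) (N+1-2*i) ?_ ?_ ?_ ?_ (abs_le.2 ⟨?_, ?_⟩) (abs_le.2 ⟨?_, ?_⟩) ?_
    any_goals omega
  · refine key (N-j+1) (N-j+1) (N-j) (N-j) (-(N+1-2*j)) ?_ ?_ ?_ ?_ (abs_le.2 ⟨?_, ?_⟩) (abs_le.2 ⟨?_, ?_⟩) ?_
    any_goals omega
  · refine key (i-1) (i-1) (i-1) i (N+1-2*i) ?_ ?_ ?_ ?_ (abs_le.2 ⟨?_, ?_⟩) (abs_le.2 ⟨?_, ?_⟩) ?_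
    any_goals omega
  · refine key (i-1) (i-1) (i-1) (i-1) (N+1-2*i) ?_ ?_ ?_ ?_ (abs_le.2 ⟨?_, ?_⟩) (abs_le.2 ⟨?_, ?_⟩) ?_
    any_goals omega
  · refine key (N-i+1) (N-i) (N-i) (N-i) (-(N+1-2*i)) ?_ ?_ ?_ ?_ (abs_le.2 ⟨?_, ?_⟩) (abs_le.2 ⟨?_, ?_⟩) ?_
    any_goals omega
  · refine key (j-1) (j-1) j j (N+1-2*j) ?_ ?_ ?_ ?_ (abs_le.2 ⟨?_, ?_⟩) (abs_le.2 ⟨?_, ?_⟩) ?_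
    any_goals omega
  · refine key (j-1) (j-1) j (j-1) (N+1-2*j) ?_ ?_ ?_ ?_ (abs_le.2 ⟨?_, ?_⟩) (abs_le.2 ⟨?_, ?_⟩) ?_
    any_goals omega
  · refine key (N-i+1) (N-i) (N-i+1) (N-i) (-(N+1-2*i)) ?_ ?_ ?_ ?_ (abs_le.2 ⟨?_, ?_⟩) (abs_le.2 ⟨?_, ?_⟩) ?_
    any_goals omega

/-- (scaled) divergence of the inward field at a cell -/
def dvg (N i j : ℕ) : ℝ :=
  (((N:ℝ)-2*i) * wv N i j - ((N:ℝ)-2*(i-1:ℕ)) * wv N (i-1) j)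
    + (((N:ℝ)-2*j) * wh N i j - ((N:ℝ)-2*(j-1:ℕ)) * wh N i (j-1))

lemma dvg_ge (N i j : ℕ) (hi : 1 ≤ i) (hi' : i ≤ N) (hj : 1 ≤ j) (hj' : j ≤ N) :
    ((6 * max |(N:ℤ)+1-2*i| |(N:ℤ)+1-2*j| - 4 * N : ℤ) : ℝ) ≤ dvg N i j := by
  have h := div_key_int N i j hi hi' hj hj' _ _ _ _ rfl rfl rfl rfl
  have h' := (Int.cast_le (R := ℝ)).2 h
  refine h'.trans (le_of_eq ?_)
  unfold dvg wv wh
  push_cast [Nat.cast_sub hi, Nat.cast_sub hj]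
  ring

lemma dvg_ge1 (N i j : ℕ) (hi : 1 ≤ i) (hi' : i ≤ N) (hj : 1 ≤ j) (hj' : j ≤ N) :
    -4 * (N:ℝ) ≤ dvg N i j := by
  refine le_trans ?_ (dvg_ge N i j hi hi' hj hj')
  have : (-4 * (N:ℤ)) ≤ 6 * max |(N:ℤ)+1-2*i| |(N:ℤ)+1-2*j| - 4 * N := by
    rw [abs_eq_max_neg, abs_eq_max_neg]; omega
  exact_mod_cast this

lemma dvg_ge2 (N i j : ℕ) (hi : 1 ≤ i) (hi' : i ≤ N) (hj : 1 ≤ j) (hj' : j ≤ N)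
    (h : ¬ ((N/12+1 ≤ i ∧ i ≤ N - N/12) ∧ (N/12+1 ≤ j ∧ j ≤ N - N/12))) :
    (N:ℝ) ≤ dvg N i j := by
  refine le_trans ?_ (dvg_ge N i j hi hi' hj hj')
  have : ((N:ℤ)) ≤ 6 * max |(N:ℤ)+1-2*i| |(N:ℤ)+1-2*j| - 4 * N := by
    rw [abs_eq_max_neg, abs_eq_max_neg]; omega
  exact_mod_cast this

lemma wv_core (N i j : ℕ) (hN : 2 ≤ N) (hi : N/12+1 ≤ i) (hi' : i < N - N/12)
    (hj : N/12+1 ≤ j) (hj' : j ≤ N - N/12) : (N:ℝ) ≤ 12 * wv N i j := by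
  unfold wv
  have : N ≤ 12 * (eta N i (j-1) + eta N i j) := by unfold eta; omega
  exact_mod_cast this

lemma eta_symm (N i j : ℕ) : eta N i j = eta N j i := by unfold eta; omega

lemma wh_eq (N i j : ℕ) : wh N i j = wv N j i := by
  unfold wh wv; rw [eta_symm N (i-1) j, eta_symm N i j]

/-! ### Improved Poincare inequality -/

/-- weighted gradient energy, vertical edges -/
def Gv (N : ℕ) (r : ℕ → ℕ → ℝ) : ℝ :=
  ∑ i ∈ Icc 1 (N-1), ∑ j ∈ Icc 1 N, (wv N i j)^2 * (r (i+1) j - r i j)^2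
/-- weighted gradient energy, horizontal edges -/
def Gh (N : ℕ) (r : ℕ → ℕ → ℝ) : ℝ :=
  ∑ i ∈ Icc 1 N, ∑ j ∈ Icc 1 (N-1), (wh N i j)^2 * (r i (j+1) - r i j)^2

lemma Gh_eq (N : ℕ) (r : ℕ → ℕ → ℝ) : Gh N r = Gv N (fun i j => r j i) := by
  unfold Gh Gv
  rw [Finset.sum_comm]
  simp only [wh_eq]

lemma Gv_nonneg (N : ℕ) (r : ℕ → ℕ → ℝ) : 0 ≤ Gv N r :=
  Finset.sum_nonneg fun _ _ => Finset.sum_nonneg fun _ _ => by positivity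

lemma Gh_nonneg (N : ℕ) (r : ℕ → ℕ → ℝ) : 0 ≤ Gh N r :=
  Finset.sum_nonneg fun _ _ => Finset.sum_nonneg fun _ _ => by positivity

lemma wv_zero (N j : ℕ) : wv N 0 j = 0 := by unfold wv eta; simp
lemma wv_top (N j : ℕ) : wv N N j = 0 := by unfold wv eta; simp

lemma sum_shift_le (f : ℕ → ℝ) (N : ℕ) (hN : 1 ≤ N) (hf : ∀ i, 0 ≤ f i) :
    ∑ i ∈ Icc 1 (N-1), (f (i+1) + f i) ≤ 2 * ∑ i ∈ Icc 1 N, f i := by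
  obtain ⟨n, rfl⟩ : ∃ n, N = n + 1 := ⟨N-1, by omega⟩
  simp only [Nat.add_sub_cancel]
  rw [Finset.sum_add_distrib]
  have h1 : ∑ i ∈ Icc 1 n, f i ≤ ∑ i ∈ Icc 1 (n+1), f i :=
    Finset.sum_le_sum_of_subset_of_nonneg (Finset.Icc_subset_Icc le_rfl (by omega))
      (fun i _ _ => hf i)
  have h2 : ∑ i ∈ Icc 1 n, f (i+1) ≤ ∑ i ∈ Icc 1 (n+1), f i := by
    have : ∑ i ∈ Icc 1 n, f (i+1) = ∑ i ∈ Icc (1+1) (n+1), f i := by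
      rw [← Finset.map_add_right_Icc 1 n 1, Finset.sum_map]; rfl
    rw [this]
    exact Finset.sum_le_sum_of_subset_of_nonneg (Finset.Icc_subset_Icc (by omega) le_rfl)
      (fun i _ _ => hf i)
  linarith

lemma stepA_v (N : ℕ) (hN : 2 ≤ N) (r : ℕ → ℕ → ℝ) :
    ∑ j ∈ Icc 1 N, ∑ i ∈ Icc 1 N, (r i j)^2 *
      (((N:ℝ)-2*i) * wv N i j - ((N:ℝ)-2*(i-1:ℕ)) * wv N (i-1) j) ≤
    N * (4 * Gv N r + (1/4) * ∑ j ∈ Icc 1 N, ∑ i ∈ Icc 1 N, (r i j)^2) := by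
  have hG : Gv N r = ∑ j ∈ Icc 1 N, ∑ i ∈ Icc 1 (N-1), (wv N i j)^2 * (r (i+1) j - r i j)^2 := by
    unfold Gv; rw [Finset.sum_comm]
  rw [hG, Finset.mul_sum, Finset.mul_sum, ← Finset.sum_add_distrib, Finset.mul_sum]
  refine Finset.sum_le_sum fun j hj => ?_
  have := sbp (fun i => ((N:ℝ)-2*i) * wv N i j) (fun i => (r i j)^2) N (by omega)
    (by simp [wv_zero]) (by simp [wv_top])
  rw [this]
  have hs := sum_shift_le (fun i => (r i j)^2) N (by omega) (fun i => sq_nonneg _)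
  have hN0 : (0:ℝ) ≤ N := Nat.cast_nonneg _
  have hb : - ∑ i ∈ Icc 1 (N-1), ((N:ℝ)-2*i) * wv N i j * ((r (i+1) j)^2 - (r i j)^2) ≤
      ∑ i ∈ Icc 1 (N-1), N * (4 * ((wv N i j)^2 * (r (i+1) j - r i j)^2)
        + (1/8) * ((r (i+1) j)^2 + (r i j)^2)) := by
    rw [← Finset.sum_neg_distrib]
    refine Finset.sum_le_sum fun i hi => ?_
    rw [Finset.mem_Icc] at hi
    have hiN : (i:ℝ) ≤ N := by exact_mod_cast (by omega : i ≤ N)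
    have hi0 : (0:ℝ) ≤ i := Nat.cast_nonneg _
    set a := wv N i j * (r (i+1) j - r i j)
    set b := r (i+1) j + r i j with hb
    have e1 : -(((N:ℝ)-2*i) * wv N i j * ((r (i+1) j)^2 - (r i j)^2)) = (2*i-N) * (a * b) := by
      simp only [a, b]; ring
    have e2 : (wv N i j)^2 * (r (i+1) j - r i j)^2 = a^2 := by simp only [a]; ring
    rw [e1, e2]
    have h1 : (2*i-N) * (a * b) ≤ N * |a*b| := by
      refine (le_abs_self _).trans ?_
      rw [abs_mul]
      refine mul_le_mul_of_nonneg_right ?_ (abs_nonneg _)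
      rw [abs_le]; constructor <;> linarith
    refine h1.trans (mul_le_mul_of_nonneg_left ?_ hN0)
    have h2 : b^2 ≤ 2 * ((r (i+1) j)^2 + (r i j)^2) := by
      rw [hb]; nlinarith [sq_nonneg (r (i+1) j - r i j)]
    have h3 : |a*b| ≤ 4 * a^2 + (1/16) * b^2 := by
      rw [abs_le]; constructor <;> nlinarith [sq_nonneg (2*a - b/4), sq_nonneg (2*a+b/4)]
    linarith
  refine hb.trans ?_
  rw [← Finset.mul_sum]
  refine mul_le_mul_of_nonneg_left ?_ hN0
  rw [Finset.sum_add_distrib, ← Finset.mul_sum, ← Finset.mul_sum]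
  linarith

lemma stepA (N : ℕ) (hN : 2 ≤ N) (r : ℕ → ℕ → ℝ) :
    ∑ i ∈ Icc 1 N, ∑ j ∈ Icc 1 N, (r i j)^2 ≤
      10 * ∑ i ∈ Icc (N/12+1) (N-N/12), ∑ j ∈ Icc (N/12+1) (N-N/12), (r i j)^2
        + 8 * (Gv N r + Gh N r) := by
  have hv := stepA_v N hN r
  have hh := stepA_v N hN (fun i j => r j i)
  rw [← Gh_eq] at hh
  rw [Finset.sum_comm, Finset.sum_comm (f := fun j i => (r i j)^2)] at hv
  simp only [← wh_eq] at hh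
  set S := ∑ i ∈ Icc 1 N, ∑ j ∈ Icc 1 N, (r i j)^2 with hS
  set I := Icc (N/12+1) (N-N/12) with hI
  set Q := ∑ i ∈ I, ∑ j ∈ I, (r i j)^2 with hQ
  have hIsub : I ⊆ Icc 1 N := Finset.Icc_subset_Icc (by omega) (by omega)
  have hQ' : Q = ∑ i ∈ Icc 1 N, ∑ j ∈ Icc 1 N, if i ∈ I ∧ j ∈ I then (r i j)^2 else 0 := by
    rw [hQ]
    have : ∀ i ∈ Icc 1 N, (∑ j ∈ Icc 1 N, if i ∈ I ∧ j ∈ I then (r i j)^2 else 0)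
        = if i ∈ I then ∑ j ∈ I, (r i j)^2 else 0 := by
      intro i _
      by_cases h : i ∈ I
      · simp only [h, true_and, if_true]
        rw [← Finset.sum_filter, Finset.filter_mem_eq_inter, Finset.inter_eq_right.2 hIsub]
      · simp [h]
    rw [Finset.sum_congr rfl this, ← Finset.sum_filter, Finset.filter_mem_eq_inter,
      Finset.inter_eq_right.2 hIsub]
  have hlow : N * S - 5 * N * Q ≤ ∑ i ∈ Icc 1 N, ∑ j ∈ Icc 1 N, (r i j)^2 * dvg N i j := by
    rw [hS, hQ', Finset.mul_sum, Finset.mul_sum, ← Finset.sum_sub_distrib]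
    refine Finset.sum_le_sum fun i hi => ?_
    rw [Finset.mul_sum, Finset.mul_sum, ← Finset.sum_sub_distrib]
    refine Finset.sum_le_sum fun j hj => ?_
    rw [Finset.mem_Icc] at hi hj
    split_ifs with h
    · have := mul_le_mul_of_nonneg_left (dvg_ge1 N i j hi.1 hi.2 hj.1 hj.2) (sq_nonneg (r i j))
      nlinarith
    · have h' : ¬ ((N/12+1 ≤ i ∧ i ≤ N - N/12) ∧ (N/12+1 ≤ j ∧ j ≤ N - N/12)) := by
        simpa only [hI, Finset.mem_Icc] using h
      have := mul_le_mul_of_nonneg_left (dvg_ge2 N i j hi.1 hi.2 hj.1 hj.2 h') (sq_nonneg (r i j))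
      nlinarith
  have hsplit : ∑ i ∈ Icc 1 N, ∑ j ∈ Icc 1 N, (r i j)^2 * dvg N i j =
      ∑ i ∈ Icc 1 N, ∑ j ∈ Icc 1 N, (r i j)^2 *
      (((N:ℝ)-2*i) * wv N i j - ((N:ℝ)-2*(i-1:ℕ)) * wv N (i-1) j)
      + ∑ i ∈ Icc 1 N, ∑ j ∈ Icc 1 N, (r i j)^2 *
      (((N:ℝ)-2*j) * wh N i j - ((N:ℝ)-2*(j-1:ℕ)) * wh N i (j-1)) := by
    rw [← Finset.sum_add_distrib]
    refine Finset.sum_congr rfl fun i _ => ?_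
    rw [← Finset.sum_add_distrib]
    refine Finset.sum_congr rfl fun j _ => ?_
    unfold dvg; ring
  have hNpos : (0:ℝ) < N := by exact_mod_cast (by omega : 0 < N)
  have hfin : N * S - 5 * N * Q ≤ N * (4 * (Gv N r + Gh N r) + (1/2) * S) := by
    rw [hsplit] at hlow
    linarith
  have : S - 5 * Q ≤ 4 * (Gv N r + Gh N r) + (1/2) * S := by
    refine le_of_mul_le_mul_left ?_ hNpos
    linarith
  linarith

lemma core_v (N : ℕ) (hN : 2 ≤ N) (r : ℕ → ℕ → ℝ) :
    (N:ℝ)^2 * ∑ j ∈ Icc (N/12+1) (N-N/12), ∑ i ∈ Ico (N/12+1) (N-N/12), (r (i+1) j - r i j)^2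
      ≤ 144 * Gv N r := by
  have hG : Gv N r = ∑ j ∈ Icc 1 N, ∑ i ∈ Icc 1 (N-1), (wv N i j)^2 * (r (i+1) j - r i j)^2 := by
    unfold Gv; rw [Finset.sum_comm]
  rw [hG]
  have h1 : ∑ j ∈ Icc (N/12+1) (N-N/12), ∑ i ∈ Ico (N/12+1) (N-N/12),
      (wv N i j)^2 * (r (i+1) j - r i j)^2 ≤
      ∑ j ∈ Icc 1 N, ∑ i ∈ Icc 1 (N-1), (wv N i j)^2 * (r (i+1) j - r i j)^2 := by
    refine (Finset.sum_le_sum fun j _ => ?_).trans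
      (Finset.sum_le_sum_of_subset_of_nonneg (Finset.Icc_subset_Icc (by omega) (by omega))
      (fun j _ _ => Finset.sum_nonneg fun i _ => by positivity))
    refine Finset.sum_le_sum_of_subset_of_nonneg ?_ (fun j _ _ => by positivity)
    intro i hi
    rw [Finset.mem_Ico] at hi
    rw [Finset.mem_Icc]; omega
  refine le_trans ?_ (mul_le_mul_of_nonneg_left h1 (by norm_num))
  rw [Finset.mul_sum, Finset.mul_sum]
  refine Finset.sum_le_sum fun j hj => ?_
  rw [Finset.mul_sum, Finset.mul_sum]
  refine Finset.sum_le_sum fun i hi => ?_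
  rw [Finset.mem_Icc] at hj
  rw [Finset.mem_Ico] at hi
  have hw := wv_core N i j hN hi.1 hi.2 hj.1 hj.2
  have hN0 : (0:ℝ) ≤ N := Nat.cast_nonneg _
  have : (N:ℝ)^2 ≤ 144 * (wv N i j)^2 := by nlinarith
  have := mul_le_mul_of_nonneg_right this (sq_nonneg (r (i+1) j - r i j))
  linarith

lemma stepB (N : ℕ) (hN : 2 ≤ N) (r : ℕ → ℕ → ℝ) :
    ∃ c : ℝ, ∑ i ∈ Icc (N/12+1) (N-N/12), ∑ j ∈ Icc (N/12+1) (N-N/12), (r i j - c)^2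
      ≤ 288 * (Gv N r + Gh N r) := by
  have hv := core_v N hN r
  have hh := core_v N hN (fun i j => r j i)
  rw [← Gh_eq] at hh
  set I := Icc (N/12+1) (N-N/12) with hI
  set V : ℕ → ℝ := fun j => ∑ i ∈ Ico (N/12+1) (N-N/12), (r (i+1) j - r i j)^2 with hV
  set H : ℕ → ℝ := fun i => ∑ j ∈ Ico (N/12+1) (N-N/12), (r i (j+1) - r i j)^2 with hH
  have hV' : (N:ℝ)^2 * ∑ j ∈ I, V j ≤ 144 * Gv N r := hv
  have hH' : (N:ℝ)^2 * ∑ j ∈ I, H j ≤ 144 * Gh N r := hh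
  have hVn : 0 ≤ ∑ j ∈ I, V j :=
    Finset.sum_nonneg fun _ _ => Finset.sum_nonneg fun _ _ => sq_nonneg _
  have hHn : 0 ≤ ∑ j ∈ I, H j :=
    Finset.sum_nonneg fun _ _ => Finset.sum_nonneg fun _ _ => sq_nonneg _
  have hcard : (I.card : ℝ) ≤ N := by
    rw [hI, Nat.card_Icc]
    exact_mod_cast (by omega : N - N/12 + 1 - (N/12+1) ≤ N)
  have hne : I.Nonempty := ⟨N/12+1, by rw [hI, Finset.mem_Icc]; omega⟩
  by_contra hcon
  push Not at hcon
  have hbig : ∑ k ∈ I, ∑ l ∈ I, (288 * (Gv N r + Gh N r)) <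
      ∑ k ∈ I, ∑ l ∈ I, ∑ i ∈ I, ∑ j ∈ I, (r i j - r k l)^2 :=
    Finset.sum_lt_sum_of_nonempty hne fun k _ => Finset.sum_lt_sum_of_nonempty hne
      fun l _ => hcon _
  have hsmall : ∑ k ∈ I, ∑ l ∈ I, ∑ i ∈ I, ∑ j ∈ I, (r i j - r k l)^2 ≤
      ∑ k ∈ I, ∑ l ∈ I, ∑ i ∈ I, ∑ j ∈ I, (2 * N * V j + 2 * N * H k) := by
    refine Finset.sum_le_sum fun k hk => Finset.sum_le_sum fun l hl => Finset.sum_le_sum fun i hi =>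
      Finset.sum_le_sum fun j hj => ?_
    rw [hI, Finset.mem_Icc] at hk hl hi hj
    have a1 := incr' (fun i => r i j) (N/12+1) (N-N/12) N k i hk.1 hi.1 hk.2 hi.2 (by omega)
    have a2 := incr' (fun j => r k j) (N/12+1) (N-N/12) N l j hl.1 hj.1 hl.2 hj.2 (by omega)
    have a1' : (r i j - r k j)^2 ≤ N * V j := a1
    have a2' : (r k j - r k l)^2 ≤ N * H k := a2
    nlinarith [sq_nonneg ((r i j - r k j) - (r k j - r k l))]
  have hev : ∑ k ∈ I, ∑ l ∈ I, ∑ i ∈ I, ∑ j ∈ I, (2 * N * V j + 2 * N * H k)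
      = (I.card:ℝ)^2 * (2 * N * I.card * (∑ j ∈ I, V j + ∑ k ∈ I, H k)) := by
    simp only [Finset.sum_add_distrib, Finset.sum_const, nsmul_eq_mul, ← Finset.mul_sum]
    ring
  have hlhs : ∑ k ∈ I, ∑ l ∈ I, (288 * (Gv N r + Gh N r))
      = (I.card:ℝ)^2 * (288 * (Gv N r + Gh N r)) := by
    simp only [Finset.sum_const, nsmul_eq_mul]
    ring
  have hN0 : (0:ℝ) ≤ N := Nat.cast_nonneg _
  have : 2 * N * I.card * (∑ j ∈ I, V j + ∑ k ∈ I, H k) ≤ 288 * (Gv N r + Gh N r) := by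
    have h1 : 2 * N * I.card * (∑ j ∈ I, V j + ∑ k ∈ I, H k) ≤
        2 * N * N * (∑ j ∈ I, V j + ∑ k ∈ I, H k) := by gcongr
    nlinarith
  have h5 := mul_le_mul_of_nonneg_left this (sq_nonneg (I.card:ℝ))
  rw [hlhs] at hbig
  rw [hev] at hsmall
  linarith

lemma improved_poincare (N : ℕ) (hN : 2 ≤ N) (r : ℕ → ℕ → ℝ) :
    ∃ c : ℝ, ∑ i ∈ Icc 1 N, ∑ j ∈ Icc 1 N, (r i j - c)^2 ≤ 2888 * (Gv N r + Gh N r) := by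
  obtain ⟨c, hc⟩ := stepB N hN r
  refine ⟨c, ?_⟩
  have h := stepA N hN (fun i j => r i j - c)
  have e1 : Gv N (fun i j => r i j - c) = Gv N r := by
    unfold Gv; simp
  have e2 : Gh N (fun i j => r i j - c) = Gh N r := by
    unfold Gh; simp
  rw [e1, e2] at h
  linarith

/-! ### Caccioppoli inequality -/

lemma pointwise (xa xb p q ρ N : ℝ) (h1 : |xa - xb| ≤ 1) (hw0 : 0 ≤ xa + xb) (hw : xa + xb ≤ N)
    (hN : 1 ≤ N) :
    (xa+xb)^2 * (ρ - (p - q))^2 ≤ 16 * (-((ρ - (p-q)) * (xa^2*p - xb^2*q)))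
      + 40 * (q^2 + p^2) + 26 * (N^2 * ρ^2) := by
  obtain ⟨w, hwd⟩ : ∃ w, w = xa + xb := ⟨_, rfl⟩
  obtain ⟨η, hη⟩ : ∃ η, η = xa - xb := ⟨_, rfl⟩
  obtain ⟨δ, hδ⟩ : ∃ δ, δ = p - q := ⟨_, rfl⟩
  obtain ⟨m, hm⟩ : ∃ m, m = (p + q)/2 := ⟨_, rfl⟩
  have hxa : xa = (w+η)/2 := by rw [hwd, hη]; ring
  have hxb : xb = (w-η)/2 := by rw [hwd, hη]; ring
  have hp : p = m + δ/2 := by rw [hm, hδ]; ring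
  have hq : q = m - δ/2 := by rw [hm, hδ]; ring
  rw [← hη] at h1
  rw [← hwd] at hw0 hw
  have hη2 : η^2 ≤ 1 := by rw [← sq_abs]; nlinarith [abs_nonneg η]
  have hw2 : w^2 ≤ N^2 := by nlinarith
  have e : xa^2*p - xb^2*q = (w^2/4 + η^2/4) * δ + w*η*m := by
    rw [hxa, hxb, hp, hq]; ring
  have e2 : q^2+p^2 = 2 * m^2 + δ^2/2 := by rw [hp, hq]; ring
  rw [e, e2, ← hwd, ← hδ]
  have b1 : -(w*η*m*δ) ≤ w^2*δ^2/16 + 4*m^2 := by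
    have h5 : (w*δ)^2 * η^2 ≤ (w*δ)^2 := mul_le_of_le_one_right (sq_nonneg _) hη2
    have h6 := sq_nonneg (w*η*δ/4 + 2*m)
    linarith
  have b2 : ρ * (w^2/4*δ) ≤ w^2*δ^2/16 + w^2*ρ^2/4 := by
    have h6 := sq_nonneg (w*δ/4 - w*ρ/2)
    linarith
  have b3 : ρ * (η^2/4*δ) ≤ η^2*δ^2/4 + ρ^2/16 := by
    have h5 : ρ^2 * η^2 ≤ ρ^2 := mul_le_of_le_one_right (sq_nonneg _) hη2
    have h6 := sq_nonneg (η*δ/2 - η*ρ/4)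
    linarith
  have b4 : ρ * (w*η*m) ≤ w^2*ρ^2 + m^2/4 := by
    have h5 : (w*ρ)^2 * η^2 ≤ (w*ρ)^2 := mul_le_of_le_one_right (sq_nonneg _) hη2
    have h6 := sq_nonneg (w*η*ρ - m/2)
    linarith
  have b5 : w^2 * (ρ-δ)^2 ≤ 2*(w^2*ρ^2) + 2*(w^2*δ^2) := by
    have h6 := sq_nonneg (w*(ρ+δ))
    linarith
  have b6 : w^2*ρ^2 ≤ N^2*ρ^2 := mul_le_mul_of_nonneg_right hw2 (sq_nonneg _)
  have b7 : ρ^2 ≤ N^2*ρ^2 := le_mul_of_one_le_left (sq_nonneg _) (one_le_pow₀ hN)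
  have b8 : 0 ≤ m^2 := sq_nonneg m
  have b9 : 0 ≤ δ^2 := sq_nonneg δ
  have b10 : 0 ≤ ρ^2 := sq_nonneg ρ
  have e3 : -((ρ-δ) * ((w^2/4 + η^2/4) * δ + w*η*m)) = w^2*δ^2/4 + η^2*δ^2/4 + w*η*m*δ
    - ρ * (w^2/4*δ) - ρ * (η^2/4*δ) - ρ * (w*η*m) := by ring
  rw [e3]
  linarith

lemma curl_identity (N : ℕ) (hN : 2 ≤ N) (r φ : ℕ → ℕ → ℝ)
    (h1 : ∀ j, φ 0 j = 0) (h2 : ∀ j, φ N j = 0) (h3 : ∀ i, φ i 0 = 0) (h4 : ∀ i, φ i N = 0) :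
    ∑ i ∈ Icc 1 (N-1), ∑ j ∈ Icc 1 N, (r (i+1) j - r i j) * (φ i j - φ i (j-1)) =
    ∑ i ∈ Icc 1 N, ∑ j ∈ Icc 1 (N-1), (r i (j+1) - r i j) * (φ i j - φ (i-1) j) := by
  rw [Finset.sum_comm (s := Icc 1 N)]
  have a1 : ∀ i, ∑ j ∈ Icc 1 N, (r (i+1) j - r i j) * (φ i j - φ i (j-1)) = _ := fun i =>
    sbp (fun j => φ i j) (fun j => r (i+1) j - r i j) N (by omega) (h3 i) (h4 i)
  have a2 : ∀ j, ∑ i ∈ Icc 1 N, (r i (j+1) - r i j) * (φ i j - φ (i-1) j) = _ := fun j =>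
    sbp (fun i => φ i j) (fun i => r i (j+1) - r i j) N (by omega) (h1 j) (h2 j)
  simp only [a1, a2]
  rw [Finset.sum_neg_distrib, Finset.sum_neg_distrib, Finset.sum_comm]
  congr 1
  refine Finset.sum_congr rfl fun j _ => Finset.sum_congr rfl fun i _ => ?_
  ring

lemma sum_pred_le (f : ℕ → ℝ) (N : ℕ) (hf : ∀ i, 0 ≤ f i) :
    ∑ j ∈ Icc 1 N, (f (j-1) + f j) ≤ 2 * ∑ j ∈ Icc 0 N, f j := by
  rw [Finset.sum_add_distrib]
  have h1 : ∑ i ∈ Icc 1 N, f i ≤ ∑ i ∈ Icc 0 N, f i :=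
    Finset.sum_le_sum_of_subset_of_nonneg (Finset.Icc_subset_Icc (by omega) (by omega))
      (fun i _ _ => hf i)
  have h2 : ∑ i ∈ Icc 1 N, f (i-1) ≤ ∑ i ∈ Icc 0 N, f i := by
    rcases Nat.eq_zero_or_pos N with h | h
    · subst h; simpa using hf 0
    · obtain ⟨n, rfl⟩ : ∃ n, N = n + 1 := ⟨N-1, by omega⟩
      have : ∑ i ∈ Icc 1 (n+1), f (i-1) = ∑ i ∈ Icc 0 n, f i := by
        rw [show Icc 1 (n+1) = Icc (0+1) (n+1) from rfl, ← Finset.map_add_right_Icc 0 n 1,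
          Finset.sum_map]
        simp
      rw [this]
      exact Finset.sum_le_sum_of_subset_of_nonneg (Finset.Icc_subset_Icc le_rfl (by omega))
        (fun i _ _ => hf i)
  linarith

lemma sum_sub_le (f : ℕ → ℝ) (N a b : ℕ) (hb : b ≤ N) (hf : ∀ i, 0 ≤ f i) :
    ∑ j ∈ Icc a b, f j ≤ ∑ j ∈ Icc 0 N, f j :=
  Finset.sum_le_sum_of_subset_of_nonneg (Finset.Icc_subset_Icc (by omega) hb) (fun i _ _ => hf i)

lemma eta_v (N i j : ℕ) (hi : i ≤ N) (hj : 1 ≤ j) (hj' : j ≤ N) :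
    |(eta N i j : ℝ) - eta N i (j-1)| ≤ 1 ∧ (eta N i j : ℝ) + eta N i (j-1) ≤ N := by
  have h1 : eta N i j ≤ eta N i (j-1) + 1 := by unfold eta; omega
  have h2 : eta N i (j-1) ≤ eta N i j + 1 := by unfold eta; omega
  have h3 : eta N i j + eta N i (j-1) ≤ N := by unfold eta; omega
  have h1' : (eta N i j : ℝ) ≤ eta N i (j-1) + 1 := by exact_mod_cast h1
  have h2' : (eta N i (j-1) : ℝ) ≤ eta N i j + 1 := by exact_mod_cast h2
  refine ⟨abs_le.2 ⟨by linarith, by linarith⟩, by exact_mod_cast h3⟩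

lemma caccioppoli (N : ℕ) (hN : 2 ≤ N) (r ω ρ1 ρ2 : ℕ → ℕ → ℝ)
    (h1 : ∀ i ∈ Icc 1 (N-1), ∀ j ∈ Icc 1 N, r (i+1) j - r i j = ρ1 i j - (ω i j - ω i (j-1)))
    (h2 : ∀ i ∈ Icc 1 N, ∀ j ∈ Icc 1 (N-1), r i (j+1) - r i j = ρ2 i j + (ω i j - ω (i-1) j)) :
    Gv N r + Gh N r ≤ 160 * ∑ i ∈ Icc 0 N, ∑ j ∈ Icc 0 N, (ω i j)^2
      + 26 * ((N:ℝ)^2 * ∑ i ∈ Icc 1 (N-1), ∑ j ∈ Icc 1 N, (ρ1 i j)^2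
        + (N:ℝ)^2 * ∑ i ∈ Icc 1 N, ∑ j ∈ Icc 1 (N-1), (ρ2 i j)^2) := by
  set φ : ℕ → ℕ → ℝ := fun i j => (eta N i j : ℝ)^2 * ω i j with hφ
  have hc := curl_identity N hN r φ (by intro j; simp [hφ, eta]) (by intro j; simp [hφ, eta])
    (by intro j; simp [hφ, eta]) (by intro j; simp [hφ, eta])
  have hN1 : (1:ℝ) ≤ N := by exact_mod_cast (by omega : 1 ≤ N)
  set S := ∑ i ∈ Icc 0 N, ∑ j ∈ Icc 0 N, (ω i j)^2 with hS
  have hv : Gv N r ≤ 16 * (-∑ i ∈ Icc 1 (N-1), ∑ j ∈ Icc 1 N,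
        (r (i+1) j - r i j) * (φ i j - φ i (j-1)))
      + 40 * ∑ i ∈ Icc 1 (N-1), ∑ j ∈ Icc 1 N, ((ω i (j-1))^2 + (ω i j)^2)
      + 26 * ((N:ℝ)^2 * ∑ i ∈ Icc 1 (N-1), ∑ j ∈ Icc 1 N, (ρ1 i j)^2) := by
    unfold Gv
    simp only [Finset.mul_sum, ← Finset.sum_neg_distrib, ← Finset.sum_add_distrib]
    refine Finset.sum_le_sum fun i hi => Finset.sum_le_sum fun j hj => ?_
    rw [h1 i hi j hj]
    rw [Finset.mem_Icc] at hi hj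
    obtain ⟨a, b⟩ := eta_v N i j (by omega) hj.1 hj.2
    have := pointwise (eta N i j) (eta N i (j-1)) (ω i j) (ω i (j-1)) (ρ1 i j) N a (by positivity) b hN1
    unfold wv
    simp only [hφ]
    linarith
  have hh : Gh N r ≤ 16 * (∑ i ∈ Icc 1 N, ∑ j ∈ Icc 1 (N-1),
        (r i (j+1) - r i j) * (φ i j - φ (i-1) j))
      + 40 * ∑ i ∈ Icc 1 N, ∑ j ∈ Icc 1 (N-1), ((ω (i-1) j)^2 + (ω i j)^2)
      + 26 * ((N:ℝ)^2 * ∑ i ∈ Icc 1 N, ∑ j ∈ Icc 1 (N-1), (ρ2 i j)^2) := by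
    unfold Gh
    simp only [Finset.mul_sum, ← Finset.sum_add_distrib]
    refine Finset.sum_le_sum fun i hi => Finset.sum_le_sum fun j hj => ?_
    rw [h2 i hi j hj]
    rw [Finset.mem_Icc] at hi hj
    obtain ⟨a, b⟩ := eta_v N j i (by omega) hi.1 hi.2
    rw [eta_symm N j i, eta_symm N j (i-1)] at a b
    have := pointwise (eta N i j) (eta N (i-1) j) (ω i j) (ω (i-1) j) (-ρ2 i j) N a (by positivity) b hN1
    unfold wh
    simp only [hφ]
    linarith
  have s1 : ∑ i ∈ Icc 1 (N-1), ∑ j ∈ Icc 1 N, ((ω i (j-1))^2 + (ω i j)^2) ≤ 2 * S := by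
    refine (Finset.sum_le_sum fun i _ =>
      sum_pred_le (fun j => (ω i j)^2) N (fun _ => sq_nonneg _)).trans ?_
    rw [← Finset.mul_sum]
    exact mul_le_mul_of_nonneg_left (sum_sub_le (fun i => ∑ j ∈ Icc 0 N, (ω i j)^2) N 1 (N-1)
      (by omega) (fun _ => Finset.sum_nonneg fun _ _ => sq_nonneg _)) (by norm_num)
  have s2 : ∑ i ∈ Icc 1 N, ∑ j ∈ Icc 1 (N-1), ((ω (i-1) j)^2 + (ω i j)^2) ≤ 2 * S := by
    rw [Finset.sum_comm, hS, Finset.sum_comm (s := Icc 0 N)]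
    refine (Finset.sum_le_sum fun j _ =>
      sum_pred_le (fun i => (ω i j)^2) N (fun _ => sq_nonneg _)).trans ?_
    rw [← Finset.mul_sum]
    exact mul_le_mul_of_nonneg_left (sum_sub_le (fun j => ∑ i ∈ Icc 0 N, (ω i j)^2) N 1 (N-1)
      (by omega) (fun _ => Finset.sum_nonneg fun _ _ => sq_nonneg _)) (by norm_num)
  rw [hc] at hv
  linarith

/-! ### Unscaled energy -/

/-- unscaled energy of the first component -/
def E1 (N : ℕ) (v : ℕ → ℕ → ℝ) : ℝ :=
  ∑ i ∈ Icc 1 N, ∑ j ∈ Icc 1 N, (v i j - v (i-1) j)^2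
   + ∑ i ∈ Icc 1 (N-1), ∑ j ∈ Icc 0 N, rho N j * (v i (j+1) - v i j)^2

/-- unscaled energy of the second component -/
def E2 (N : ℕ) (v : ℕ → ℕ → ℝ) : ℝ :=
   ∑ i ∈ Icc 0 N, ∑ j ∈ Icc 1 (N-1), rho N i * (v (i+1) j - v i j)^2
   + ∑ i ∈ Icc 1 N, ∑ j ∈ Icc 1 N, (v i j - v i (j-1))^2

lemma E2_eq (N : ℕ) (v : ℕ → ℕ → ℝ) : E2 N v = E1 N (fun i j => v j i) := by
  unfold E1 E2
  rw [Finset.sum_comm, add_comm, Finset.sum_comm (s := Icc 1 N)]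

lemma V2_swap {N : ℕ} {v : ℕ → ℕ → ℝ} (h : inV2 N v) : inV1 N (fun i j => v j i) := h

lemma rho_pos (N j : ℕ) : 1/2 ≤ rho N j := by unfold rho; split_ifs <;> norm_num

/-- unscaled Laplacian -/
def ulap (v : ℕ → ℕ → ℝ) (i j : ℕ) : ℝ :=
  (v (i+1) j - 2 * v i j + v (i-1) j) + (v i (j+1) - 2 * v i j + v i (j-1))

lemma energy1 (N : ℕ) (hN : 2 ≤ N) (v : ℕ → ℕ → ℝ) (h : inV1 N v) :
    ∑ i ∈ Icc 1 (N-1), ∑ j ∈ Icc 1 N, (-ulap v i j) * v i j = E1 N v := by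
  obtain ⟨a, b, c, d⟩ := h
  unfold E1
  have h1 : ∀ i, ∑ j ∈ Icc 0 N, rho N j * (v i (j+1) - v i j)^2 = _ := fun i =>
    (energy_y (fun j => v i j) N (by omega) (c i) (d i)).symm
  have h2 : ∀ j, ∑ i ∈ Icc 1 N, (v i j - v (i-1) j)^2 = _ := fun j =>
    (energy_x (fun i => v i j) N (by omega) (a j) (b j)).symm
  rw [Finset.sum_comm (s := Icc 1 N)]
  simp only [h1, h2]
  rw [Finset.sum_comm (s := Icc 1 N), ← Finset.sum_add_distrib]
  refine Finset.sum_congr rfl fun i _ => ?_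
  rw [← Finset.sum_add_distrib]
  refine Finset.sum_congr rfl fun j _ => ?_
  unfold ulap; ring

lemma E1_parts (N : ℕ) (v : ℕ → ℕ → ℝ) :
    0 ≤ ∑ i ∈ Icc 1 N, ∑ j ∈ Icc 1 N, (v i j - v (i-1) j)^2 ∧
    0 ≤ ∑ i ∈ Icc 1 (N-1), ∑ j ∈ Icc 0 N, rho N j * (v i (j+1) - v i j)^2 :=
  ⟨Finset.sum_nonneg fun _ _ => Finset.sum_nonneg fun _ _ => sq_nonneg _,
   Finset.sum_nonneg fun _ _ => Finset.sum_nonneg fun j _ =>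
     mul_nonneg (by linarith [rho_pos N j]) (sq_nonneg _)⟩

lemma poincare1 (N : ℕ) (hN : 2 ≤ N) (v : ℕ → ℕ → ℝ) (h : inV1 N v) :
    ∑ i ∈ Icc 1 (N-1), ∑ j ∈ Icc 1 N, (v i j)^2 ≤ (N:ℝ)^2 * E1 N v := by
  obtain ⟨a, b, c, d⟩ := h
  obtain ⟨p1, p2⟩ := E1_parts N v
  have hN0 : (0:ℝ) ≤ N := Nat.cast_nonneg _
  have key : ∀ i ∈ Icc 1 (N-1), ∑ j ∈ Icc 1 N, (v i j)^2 ≤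
      N * ∑ i ∈ Icc 1 N, ∑ j ∈ Icc 1 N, (v i j - v (i-1) j)^2 := by
    intro i hi
    rw [Finset.mem_Icc] at hi
    rw [Finset.sum_comm (s := Icc 1 N) (t := Icc 1 N), Finset.mul_sum]
    refine Finset.sum_le_sum fun j _ => ?_
    have := incr (fun i => v i j) 0 N N 0 i le_rfl (by omega) (by omega) (by omega)
    simp only [a j, sub_zero] at this
    refine this.trans (le_of_eq ?_)
    congr 1
    have : Icc 1 N = (Ico 0 N).map (addRightEmbedding 1) := by
      rw [Finset.map_add_right_Ico]; ext x; simp only [Finset.mem_Icc, Finset.mem_Ico]; omega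
    rw [this, Finset.sum_map]
    simp
  refine (Finset.sum_le_sum key).trans ?_
  rw [Finset.sum_const, nsmul_eq_mul, Nat.card_Icc]
  have hc : ((N - 1 + 1 - 1 : ℕ) : ℝ) ≤ N := by exact_mod_cast (by omega)
  unfold E1
  calc _ ≤ (N:ℝ) * (N * ∑ i ∈ Icc 1 N, ∑ j ∈ Icc 1 N, (v i j - v (i-1) j)^2) := by
        gcongr
    _ ≤ _ := by rw [← mul_assoc, ← pow_two]; gcongr; linarith

lemma grad_perp1 (N : ℕ) (hN : 2 ≤ N) (v : ℕ → ℕ → ℝ) (h : inV1 N v) :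
    ∑ i ∈ Icc 0 N, ∑ j ∈ Icc 0 N, (v i (j+1) - v i j)^2 ≤ 2 * E1 N v := by
  obtain ⟨a, b, c, d⟩ := h
  obtain ⟨p1, p2⟩ := E1_parts N v
  rw [Icc_zero_split _ N (by omega)]
  simp only [a, b, sub_zero]
  have : ∑ i ∈ Icc 1 (N-1), ∑ j ∈ Icc 0 N, (v i (j+1) - v i j)^2 ≤
      2 * ∑ i ∈ Icc 1 (N-1), ∑ j ∈ Icc 0 N, rho N j * (v i (j+1) - v i j)^2 := by
    rw [Finset.mul_sum]
    refine Finset.sum_le_sum fun i _ => ?_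
    rw [Finset.mul_sum]
    refine Finset.sum_le_sum fun j _ => ?_
    have := mul_le_mul_of_nonneg_right (rho_pos N j) (sq_nonneg (v i (j+1) - v i j))
    linarith
  unfold E1
  simp
  linarith

lemma young_sum (s t : Finset ℕ) (f g : ℕ → ℕ → ℝ) (ε : ℝ) (hε : 0 < ε) :
    ∑ i ∈ s, ∑ j ∈ t, f i j * g i j ≤
      ε * ∑ i ∈ s, ∑ j ∈ t, (f i j)^2 + (1/(4*ε)) * ∑ i ∈ s, ∑ j ∈ t, (g i j)^2 := by
  simp only [Finset.mul_sum, ← Finset.sum_add_distrib]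
  refine Finset.sum_le_sum fun i _ => Finset.sum_le_sum fun j _ => ?_
  have : ε * (f i j)^2 + (1/(4*ε)) * (g i j)^2 - f i j * g i j
      = (1/(4*ε)) * (2*ε*f i j - g i j)^2 := by field_simp; ring
  have : 0 ≤ (1/(4*ε)) * (2*ε*f i j - g i j)^2 := by positivity
  linarith

lemma main_unscaled (N : ℕ) (hN : 2 ≤ N) (e1 e2 P ρ1 ρ2 D : ℕ → ℕ → ℝ)
    (hV1 : inV1 N e1) (hV2 : inV2 N e2) (hM : inM N P)
    (h1 : ∀ i ∈ Icc 1 (N-1), ∀ j ∈ Icc 1 N, -ulap e1 i j + (P (i+1) j - P i j) = ρ1 i j)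
    (h2 : ∀ i ∈ Icc 1 N, ∀ j ∈ Icc 1 (N-1), -ulap e2 i j + (P i (j+1) - P i j) = ρ2 i j)
    (h3 : ∀ i ∈ Icc 1 N, ∀ j ∈ Icc 1 N, (e1 i j - e1 (i-1) j) + (e2 i j - e2 i (j-1)) = D i j) :
    E1 N e1 + E2 N e2 ≤ 100000000 * (
      (N:ℝ)^2 * ∑ i ∈ Icc 1 (N-1), ∑ j ∈ Icc 1 N, (ρ1 i j)^2
      + (N:ℝ)^2 * ∑ i ∈ Icc 1 N, ∑ j ∈ Icc 1 (N-1), (ρ2 i j)^2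
      + ∑ i ∈ Icc 1 N, ∑ j ∈ Icc 1 N, (D i j)^2) := by
  have hNpos : (0:ℝ) < N := by exact_mod_cast (by omega : 0 < N)
  set ω : ℕ → ℕ → ℝ := fun i j => (e2 (i+1) j - e2 i j) - (e1 i (j+1) - e1 i j) with hω
  set r : ℕ → ℕ → ℝ := fun i j => P i j - D i j with hr
  have q1 : ∀ i ∈ Icc 1 (N-1), ∀ j ∈ Icc 1 N,
      r (i+1) j - r i j = ρ1 i j - (ω i j - ω i (j-1)) := by
    intro i hi j hj
    have a := h1 i hi j hj
    rw [Finset.mem_Icc] at hi hj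
    have b := h3 i (by rw [Finset.mem_Icc]; omega) j (by rw [Finset.mem_Icc]; omega)
    have c := h3 (i+1) (by rw [Finset.mem_Icc]; omega) j (by rw [Finset.mem_Icc]; omega)
    simp only [hr, hω, ulap, Nat.add_sub_cancel, Nat.sub_add_cancel hj.1] at *
    linarith
  have q2 : ∀ i ∈ Icc 1 N, ∀ j ∈ Icc 1 (N-1),
      r i (j+1) - r i j = ρ2 i j + (ω i j - ω (i-1) j) := by
    intro i hi j hj
    have a := h2 i hi j hj
    rw [Finset.mem_Icc] at hi hj
    have b := h3 i (by rw [Finset.mem_Icc]; omega) j (by rw [Finset.mem_Icc]; omega)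
    have c := h3 i (by rw [Finset.mem_Icc]; omega) (j+1) (by rw [Finset.mem_Icc]; omega)
    simp only [hr, hω, ulap, Nat.add_sub_cancel, Nat.sub_add_cancel hi.1] at *
    linarith
  have hcac := caccioppoli N hN r ω ρ1 ρ2 q1 q2
  obtain ⟨c, hc⟩ := improved_poincare N hN r
  have hV2' := V2_swap hV2
  -- bound on vorticity
  have hωb : ∑ i ∈ Icc 0 N, ∑ j ∈ Icc 0 N, (ω i j)^2 ≤ 4 * (E1 N e1 + E2 N e2) := by
    have g1 := grad_perp1 N hN e1 hV1
    have g2 := grad_perp1 N hN _ hV2'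
    rw [← E2_eq, Finset.sum_comm] at g2
    have : ∑ i ∈ Icc 0 N, ∑ j ∈ Icc 0 N, (ω i j)^2 ≤
        2 * ∑ i ∈ Icc 0 N, ∑ j ∈ Icc 0 N, (e2 (i+1) j - e2 i j)^2
        + 2 * ∑ i ∈ Icc 0 N, ∑ j ∈ Icc 0 N, (e1 i (j+1) - e1 i j)^2 := by
      simp only [Finset.mul_sum, ← Finset.sum_add_distrib]
      refine Finset.sum_le_sum fun i _ => Finset.sum_le_sum fun j _ => ?_
      simp only [hω]
      nlinarith [sq_nonneg ((e2 (i+1) j - e2 i j) + (e1 i (j+1) - e1 i j))]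
    linarith
  set E := E1 N e1 + E2 N e2 with hE
  set A := (N:ℝ)^2 * ∑ i ∈ Icc 1 (N-1), ∑ j ∈ Icc 1 N, (ρ1 i j)^2 with hA
  set B := (N:ℝ)^2 * ∑ i ∈ Icc 1 N, ∑ j ∈ Icc 1 (N-1), (ρ2 i j)^2 with hB
  set T := ∑ i ∈ Icc 1 N, ∑ j ∈ Icc 1 N, (D i j)^2 with hT
  -- pressure bound
  have hPc : ∑ i ∈ Icc 1 N, ∑ j ∈ Icc 1 N, (P i j)^2 ≤
      ∑ i ∈ Icc 1 N, ∑ j ∈ Icc 1 N, (P i j - c)^2 := by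
    have e : ∑ i ∈ Icc 1 N, ∑ j ∈ Icc 1 N, (P i j - c)^2 =
        ∑ i ∈ Icc 1 N, ∑ j ∈ Icc 1 N, (P i j)^2 - 2 * c * ∑ i ∈ Icc 1 N, ∑ j ∈ Icc 1 N, P i j
        + ∑ i ∈ Icc 1 N, ∑ j ∈ Icc 1 N, c^2 := by
      simp only [Finset.mul_sum, ← Finset.sum_add_distrib, ← Finset.sum_sub_distrib]
      refine Finset.sum_congr rfl fun i _ => Finset.sum_congr rfl fun j _ => ?_
      ring
    unfold inM at hM
    rw [e, hM]
    have : 0 ≤ ∑ i ∈ Icc 1 N, ∑ j ∈ Icc 1 N, c^2 :=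
      Finset.sum_nonneg fun _ _ => Finset.sum_nonneg fun _ _ => sq_nonneg _
    linarith
  have hPr : ∑ i ∈ Icc 1 N, ∑ j ∈ Icc 1 N, (P i j - c)^2 ≤
      2 * ∑ i ∈ Icc 1 N, ∑ j ∈ Icc 1 N, (r i j - c)^2 + 2 * T := by
    rw [hT]
    simp only [Finset.mul_sum, ← Finset.sum_add_distrib]
    refine Finset.sum_le_sum fun i _ => Finset.sum_le_sum fun j _ => ?_
    simp only [hr]
    nlinarith [sq_nonneg ((P i j - D i j - c) - D i j)]
  have hP : ∑ i ∈ Icc 1 N, ∑ j ∈ Icc 1 N, (P i j)^2 ≤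
      4000000 * E + 200000 * (A + B + T) := by
    have hE0 : 0 ≤ ∑ i ∈ Icc 0 N, ∑ j ∈ Icc 0 N, (ω i j)^2 :=
      Finset.sum_nonneg fun _ _ => Finset.sum_nonneg fun _ _ => sq_nonneg _
    have hA0 : 0 ≤ A := mul_nonneg (sq_nonneg _)
      (Finset.sum_nonneg fun _ _ => Finset.sum_nonneg fun _ _ => sq_nonneg _)
    have hB0 : 0 ≤ B := mul_nonneg (sq_nonneg _)
      (Finset.sum_nonneg fun _ _ => Finset.sum_nonneg fun _ _ => sq_nonneg _)
    have hT0 : 0 ≤ T := Finset.sum_nonneg fun _ _ => Finset.sum_nonneg fun _ _ => sq_nonneg _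
    linarith
  -- energy identity
  have en : E = ∑ i ∈ Icc 1 (N-1), ∑ j ∈ Icc 1 N, e1 i j * ρ1 i j
      + ∑ i ∈ Icc 1 N, ∑ j ∈ Icc 1 (N-1), e2 i j * ρ2 i j
      + ∑ i ∈ Icc 1 N, ∑ j ∈ Icc 1 N, P i j * D i j := by
    have a1 := energy1 N hN e1 hV1
    have a2 := energy1 N hN _ hV2'
    rw [← E2_eq, Finset.sum_comm] at a2
    have p1 : ∑ i ∈ Icc 1 N, ∑ j ∈ Icc 1 N, P i j * (e1 i j - e1 (i-1) j) =
        - ∑ i ∈ Icc 1 (N-1), ∑ j ∈ Icc 1 N, e1 i j * (P (i+1) j - P i j) := by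
      rw [Finset.sum_comm, Finset.sum_comm (s := Icc 1 (N-1)), ← Finset.sum_neg_distrib]
      exact Finset.sum_congr rfl fun j _ =>
        sbp (fun i => e1 i j) (fun i => P i j) N (by omega) (hV1.1 j) (hV1.2.1 j)
    have p2 : ∑ i ∈ Icc 1 N, ∑ j ∈ Icc 1 N, P i j * (e2 i j - e2 i (j-1)) =
        - ∑ i ∈ Icc 1 N, ∑ j ∈ Icc 1 (N-1), e2 i j * (P i (j+1) - P i j) := by
      rw [← Finset.sum_neg_distrib]
      exact Finset.sum_congr rfl fun i _ =>
        sbp (fun j => e2 i j) (fun j => P i j) N (by omega) (hV2.1 i) (hV2.2.1 i)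
    have p3 : ∑ i ∈ Icc 1 N, ∑ j ∈ Icc 1 N, P i j * D i j =
        ∑ i ∈ Icc 1 N, ∑ j ∈ Icc 1 N, P i j * (e1 i j - e1 (i-1) j)
        + ∑ i ∈ Icc 1 N, ∑ j ∈ Icc 1 N, P i j * (e2 i j - e2 i (j-1)) := by
      simp only [← Finset.sum_add_distrib]
      refine Finset.sum_congr rfl fun i hi => Finset.sum_congr rfl fun j hj => ?_
      rw [← h3 i hi j hj]; ring
    have p4 : ∑ i ∈ Icc 1 (N-1), ∑ j ∈ Icc 1 N, e1 i j * ρ1 i j =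
        E1 N e1 + ∑ i ∈ Icc 1 (N-1), ∑ j ∈ Icc 1 N, e1 i j * (P (i+1) j - P i j) := by
      rw [← a1]
      simp only [← Finset.sum_add_distrib]
      refine Finset.sum_congr rfl fun i hi => Finset.sum_congr rfl fun j hj => ?_
      rw [← h1 i hi j hj]; ring
    have p5 : ∑ i ∈ Icc 1 N, ∑ j ∈ Icc 1 (N-1), e2 i j * ρ2 i j =
        E2 N e2 + ∑ i ∈ Icc 1 N, ∑ j ∈ Icc 1 (N-1), e2 i j * (P i (j+1) - P i j) := by
      rw [← a2]
      simp only [← Finset.sum_add_distrib]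
      refine Finset.sum_congr rfl fun i hi => Finset.sum_congr rfl fun j hj => ?_
      rw [← h2 i hi j hj]; unfold ulap; ring
    rw [p3, p1, p2, p4, p5]; ring
  have y1 := young_sum (Icc 1 (N-1)) (Icc 1 N) e1 ρ1 (1/(4*(N:ℝ)^2)) (by positivity)
  have y2 := young_sum (Icc 1 N) (Icc 1 (N-1)) e2 ρ2 (1/(4*(N:ℝ)^2)) (by positivity)
  have y3 := young_sum (Icc 1 N) (Icc 1 N) P D (1/16000000) (by norm_num)
  have hN2 : 1/(4*(1/(4*(N:ℝ)^2))) = (N:ℝ)^2 := by field_simp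
  rw [hN2] at y1 y2
  have z1 := poincare1 N hN e1 hV1
  have z2 := poincare1 N hN _ hV2'
  rw [← E2_eq, Finset.sum_comm] at z2
  have z1' : 1/(4*(N:ℝ)^2) * ∑ i ∈ Icc 1 (N-1), ∑ j ∈ Icc 1 N, (e1 i j)^2 ≤ (1/4) * E1 N e1 := by
    calc _ ≤ 1/(4*(N:ℝ)^2) * ((N:ℝ)^2 * E1 N e1) := mul_le_mul_of_nonneg_left z1 (by positivity)
      _ = _ := by field_simp
  have z2' : 1/(4*(N:ℝ)^2) * ∑ i ∈ Icc 1 N, ∑ j ∈ Icc 1 (N-1), (e2 i j)^2 ≤ (1/4) * E2 N e2 := by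
    calc _ ≤ 1/(4*(N:ℝ)^2) * ((N:ℝ)^2 * E2 N e2) := mul_le_mul_of_nonneg_left z2 (by positivity)
      _ = _ := by field_simp
  have hA0 : 0 ≤ A := mul_nonneg (sq_nonneg _)
    (Finset.sum_nonneg fun _ _ => Finset.sum_nonneg fun _ _ => sq_nonneg _)
  have hB0 : 0 ≤ B := mul_nonneg (sq_nonneg _)
    (Finset.sum_nonneg fun _ _ => Finset.sum_nonneg fun _ _ => sq_nonneg _)
  have hT0 : 0 ≤ T := Finset.sum_nonneg fun _ _ => Finset.sum_nonneg fun _ _ => sq_nonneg _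
  norm_num at y3
  linarith

/-- discrete gradient stability:
`|e|₁ ≤ C (‖R¹‖_{V¹} + ‖R²‖_{V²} + ‖R‖_{M})` with `C` independent of `N`. -/
theorem discrete_gradient_stability :
    ∃ C : ℝ, 0 < C ∧ ∀ N : ℕ, 2 ≤ N →
      ∀ e1 e2 ep R1 R2 R : ℕ → ℕ → ℝ,
        inV1 N e1 → inV2 N e2 → inM N ep →
        StokesSys N e1 e2 ep R1 R2 R →
        H1semi N e1 e2
          ≤ C * (Real.sqrt (innerV1 N R1 R1) + Real.sqrt (innerV2 N R2 R2)
              + Real.sqrt (innerM N R R)) := by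
  refine ⟨10000, by norm_num, ?_⟩
  intro N hN e1 e2 ep R1 R2 R hV1 hV2 hM hS
  obtain ⟨s1, s2, s3⟩ := hS
  have hNpos : (0:ℝ) < N := by exact_mod_cast (by omega : 0 < N)
  have hgh : gh N = 1 / (N:ℝ) := rfl
  have hm := main_unscaled N hN e1 e2 (fun i j => gh N * ep i j) (fun i j => gh N ^ 2 * R1 i j)
    (fun i j => gh N ^ 2 * R2 i j) (fun i j => gh N * R i j) hV1 hV2
    (by
      unfold inM at *
      simp only [← Finset.mul_sum]
      rw [hM, mul_zero])
    (by
      intro i hi j hj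
      rw [← s1 i hi j hj]
      unfold lap d1pM ulap
      rw [hgh]; field_simp)
    (by
      intro i hi j hj
      rw [← s2 i hi j hj]
      unfold lap d2pM ulap
      rw [hgh]; field_simp)
    (by
      intro i hi j hj
      rw [← s3 i hi j hj]
      unfold d1V1 d2V2
      rw [hgh]; field_simp)
  have hE : H1semisq N e1 e2 = E1 N e1 + E2 N e2 := by
    have t : ∀ x : ℝ, gh N ^ 2 * (x / gh N * (x / gh N)) = x^2 := by
      intro x; rw [hgh]; field_simp
    have t' : ∀ c x : ℝ, gh N ^ 2 * (c * (x / gh N * (x / gh N))) = c * x^2 := by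
      intro c x; rw [hgh]; field_simp
    unfold H1semisq E1 E2 innerM innerW1 innerW2 d1V1 d2V1 d1V2 d2V2
    simp only [Finset.mul_sum, t, t']
    ring
  have hR1 : (N:ℝ)^2 * ∑ i ∈ Icc 1 (N-1), ∑ j ∈ Icc 1 N, (gh N ^ 2 * R1 i j)^2
      = innerV1 N R1 R1 := by
    unfold innerV1
    simp only [Finset.mul_sum]
    refine Finset.sum_congr rfl fun i _ => Finset.sum_congr rfl fun j _ => ?_
    rw [hgh]; field_simp
  have hR2 : (N:ℝ)^2 * ∑ i ∈ Icc 1 N, ∑ j ∈ Icc 1 (N-1), (gh N ^ 2 * R2 i j)^2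
      = innerV2 N R2 R2 := by
    unfold innerV2
    simp only [Finset.mul_sum]
    refine Finset.sum_congr rfl fun i _ => Finset.sum_congr rfl fun j _ => ?_
    rw [hgh]; field_simp
  have hR : ∑ i ∈ Icc 1 N, ∑ j ∈ Icc 1 N, (gh N * R i j)^2 = innerM N R R := by
    unfold innerM
    simp only [Finset.mul_sum]
    refine Finset.sum_congr rfl fun i _ => Finset.sum_congr rfl fun j _ => ?_
    ring
  rw [hR1, hR2, hR, ← hE] at hm
  have n1 : 0 ≤ innerV1 N R1 R1 := mul_nonneg (sq_nonneg _)
    (Finset.sum_nonneg fun _ _ => Finset.sum_nonneg fun _ _ => mul_self_nonneg _)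
  have n2 : 0 ≤ innerV2 N R2 R2 := mul_nonneg (sq_nonneg _)
    (Finset.sum_nonneg fun _ _ => Finset.sum_nonneg fun _ _ => mul_self_nonneg _)
  have n3 : 0 ≤ innerM N R R := mul_nonneg (sq_nonneg _)
    (Finset.sum_nonneg fun _ _ => Finset.sum_nonneg fun _ _ => mul_self_nonneg _)
  unfold H1semi
  have r1 := Real.sqrt_nonneg (innerV1 N R1 R1)
  have r2 := Real.sqrt_nonneg (innerV2 N R2 R2)
  have r3 := Real.sqrt_nonneg (innerM N R R)
  refine Real.sqrt_le_iff.2 ⟨by positivity, hm.trans ?_⟩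
  have k1 := Real.sq_sqrt n1
  have k2 := Real.sq_sqrt n2
  have k3 := Real.sq_sqrt n3
  have m1 := mul_nonneg r1 r2
  have m2 := mul_nonneg r1 r3
  have m3 := mul_nonneg r2 r3
  nlinarith
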